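/- arXiv:1403.0178 — 10 statements merged into one kernel-verified Lean document; each statement's English description precedes it below -/
import Mathlib

section
/- For every simple graph G on n vertices there exists a spanning subgraph H of G (a graph on the same vertex set with H ≤ G) such that (i) for every pair of vertices u, v that are reachable in G, u and v are reachable in H and d_H(u,v) ≤ d_G(u,v) + 6, and (ii) the number of edges of H is at most C · n^{4/3} for some absolute constant C independent of G and n. -/
namespace Spanner

open Finset

/-- `a` and `b` are joined in `H` by a walk of length at most `n`. -/
def R {V : Type} (H : SimpleGraph V) (n : ℕ) (a b : V) : Prop :=
  ∃ p : H.Walk a b, p.length ≤ n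

section basics
variable {V : Type} {H H' : SimpleGraph V} {a b c : V} {m n : ℕ}

lemma R.refl (a : V) : R H 0 a a := ⟨SimpleGraph.Walk.nil, by simp⟩

lemma R.adj (h : H.Adj a b) : R H 1 a b := ⟨h.toWalk, by simp⟩

lemma R.trans (h₁ : R H m a b) (h₂ : R H n b c) : R H (m + n) a c := by
  obtain ⟨p, hp⟩ := h₁
  obtain ⟨q, hq⟩ := h₂
  exact ⟨p.append q, by rw [SimpleGraph.Walk.length_append]; omega⟩

lemma R.symm (h : R H m a b) : R H m b a := by
  obtain ⟨p, hp⟩ := h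
  exact ⟨p.reverse, by simpa using hp⟩

lemma R.mono (h : R H m a b) (hmn : m ≤ n) : R H n a b := by
  obtain ⟨p, hp⟩ := h
  exact ⟨p, hp.trans hmn⟩

lemma R.le (h : R H m a b) (hH : H ≤ H') : R H' m a b := by
  obtain ⟨p, hp⟩ := h
  exact ⟨p.mapLe hH, by simpa using hp⟩

lemma R.dist_le (h : R H m a b) : H.dist a b ≤ m := by
  obtain ⟨p, hp⟩ := h
  exact (SimpleGraph.dist_le p).trans hp

lemma R.reachable (h : R H m a b) : H.Reachable a b := by
  obtain ⟨p, hp⟩ := h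
  exact ⟨p⟩

lemma R.of_reachable (h : H.Reachable a b) : R H (H.dist a b) a b := by
  obtain ⟨p, hp⟩ := h.exists_walk_length_eq_dist
  exact ⟨p, hp.le⟩

lemma R.path {w : ℕ → V} {k : ℕ} (hw : ∀ j < k, H.Adj (w j) (w (j + 1))) (i d : ℕ)
    (h : i + d ≤ k) : R H d (w i) (w (i + d)) := by
  induction d with
  | zero => exact R.refl _
  | succ d ih => exact (ih (by omega)).trans (R.adj (hw _ (by omega)))

end basics

open Classical in
/-- neighbours -/
noncomputable def N {V : Type} [Fintype V] (H : SimpleGraph V) (v : V) : Finset V :=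
  univ.filter (H.Adj v)

open Classical in
/-- the set of good triples -/
noncomputable def Phi {V : Type} [Fintype V] (G H : SimpleGraph V) : Finset ((V × V) × Fin 5) :=
  univ.filter fun t => R H (G.dist t.1.1 t.1.2 + t.2) t.1.1 t.1.2

/-- the potential -/
noncomputable def Psi {V : Type} [Fintype V] (G : SimpleGraph V) (D : ℕ) (H : SimpleGraph V) : ℤ :=
  2 * (D : ℤ) ^ 2 * (∑ v, min D (#(N H v)) : ℕ) + 4 * (#(Phi G H) : ℤ)
    - (D : ℤ) ^ 2 * (H.edgeSet.ncard : ℤ)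

section main
variable {V : Type} [Fintype V] {G H H' : SimpleGraph V} {D : ℕ}

lemma N_mono (h : H ≤ H') (v : V) : N H v ⊆ N H' v := by
  classical
  intro x hx
  simp only [N, mem_filter, mem_univ, true_and] at hx ⊢
  exact h hx

lemma Phi_mono (h : H ≤ H') : Phi G H ⊆ Phi G H' := by
  classical
  intro x hx
  simp only [Phi, mem_filter, mem_univ, true_and] at hx ⊢
  exact hx.le h

lemma edge_bound (H : SimpleGraph V) (S : Finset (Sym2 V)) :
    (H ⊔ SimpleGraph.fromEdgeSet (S : Set (Sym2 V))).edgeSet.ncard ≤ H.edgeSet.ncard + #S := by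
  rw [SimpleGraph.edgeSet_sup, SimpleGraph.edgeSet_fromEdgeSet]
  refine (Set.ncard_union_le _ _).trans ?_
  gcongr
  refine (Set.ncard_le_ncard Set.sdiff_subset (Set.toFinite _)).trans ?_
  simp

/-- Endpoints of missing edges have large degree. -/
lemma deg_large (hD : 0 < D) (hHG : H ≤ G) (hmax : ∀ K ≤ G, Psi G D K ≤ Psi G D H) {a b : V}
    (hab : G.Adj a b) (hnab : ¬ H.Adj a b) : D ≤ #(N H a) := by
  classical
  by_contra! hlt
  set K := H ⊔ SimpleGraph.fromEdgeSet ((({s(a, b)} : Finset (Sym2 V)) : Set (Sym2 V))) with hK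
  have hHK : H ≤ K := le_sup_left
  have hKG : K ≤ G := by
    refine sup_le hHG ?_
    intro x y hxy
    simp only [coe_singleton, SimpleGraph.fromEdgeSet_adj, Set.mem_singleton_iff] at hxy
    have := hxy.1
    rw [← SimpleGraph.mem_edgeSet, this]
    exact hab
  have hKab : K.Adj a b := by
    rw [hK, SimpleGraph.sup_adj]
    right
    simp [hab.ne]
  have hE := edge_bound H {s(a, b)}
  rw [← hK, card_singleton] at hE
  have hP := card_le_card (Phi_mono (G := G) hHK)
  have hS : ∑ v, min D (#(N H v)) < ∑ v, min D (#(N K v)) := by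
    refine sum_lt_sum (fun v _ => ?_) ⟨a, mem_univ _, ?_⟩
    · exact min_le_min le_rfl (card_le_card (N_mono hHK v))
    · have : #(N H a) < #(N K a) := by
        refine card_lt_card ⟨N_mono hHK a, fun h => hnab ?_⟩
        have := h (show b ∈ N K a by simp [N, hKab])
        simpa [N] using this
      omega
  have h := hmax K hKG
  unfold Psi at h
  have hD2 : (0 : ℤ) < (D : ℤ) ^ 2 := by positivity
  zify at hE hP hS
  push_cast at h
  nlinarith [mul_le_mul_of_nonneg_left hE hD2.le,
    mul_le_mul_of_nonneg_left (Int.add_one_le_iff.mpr hS) hD2.le]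

/-- A maximizer is a spanner. -/
lemma spanner (hD : 0 < D) (hHG : H ≤ G) (hmax : ∀ K ≤ G, Psi G D K ≤ Psi G D H) :
    ∀ (k : ℕ) (u v : V), G.Reachable u v → G.dist u v = k → R H (k + 6) u v := by
  classical
  intro k
  induction k using Nat.strong_induction_on with
  | _ k ih =>
  intro u v huv hk
  by_contra hbad
  obtain ⟨p, hp⟩ := huv.exists_walk_length_eq_dist
  rw [hk] at hp
  have hk0 : 0 < k := by
    rcases Nat.eq_zero_or_pos k with h | h
    · subst h
      have := (huv.dist_eq_zero_iff).mp hk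
      subst this
      exact absurd ((R.refl u).mono (by omega)) hbad
    · exact h
  obtain ⟨w, hw0, hwk, hw⟩ : ∃ w : ℕ → V, w 0 = u ∧ w k = v ∧
      ∀ j < k, G.Adj (w j) (w (j + 1)) := by
    refine ⟨p.getVert, by simp, ?_, fun j hj => p.adj_getVert_succ (by omega)⟩
    rw [← hp]; simp
  have hsub : ∀ i d, i + d ≤ k → R G d (w i) (w (i + d)) := fun i d h => R.path hw i d h
  have hui : ∀ i ≤ k, R G i u (w i) := fun i hi => by
    have := hsub 0 i (by omega)
    rwa [hw0, zero_add] at this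
  have hiv : ∀ i ≤ k, R G (k - i) (w i) v := fun i hi => by
    have := hsub i (k - i) (by omega)
    rwa [show i + (k - i) = k by omega, hwk] at this
  have hlow : ∀ m, R G m u v → k ≤ m := fun m h => hk ▸ h.dist_le
  -- first edge is missing
  have hfirst : ¬ H.Adj (w 0) (w 1) := by
    intro hadj
    have h1 := hiv 1 hk0
    have h2 := h1.dist_le
    have h3 := ih (G.dist (w 1) v) (by omega) (w 1) v h1.reachable rfl
    apply hbad
    rw [← hw0]
    exact ((R.adj hadj).trans h3).mono (by omega)
  have hlast : ¬ H.Adj (w (k - 1)) (w k) := by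
    intro hadj
    have h1 := hui (k - 1) (by omega)
    have h2 := h1.dist_le
    have h3 := ih (G.dist u (w (k - 1))) (by omega) u (w (k - 1)) h1.reachable rfl
    apply hbad
    rw [← hwk]
    exact (h3.trans (R.adj hadj)).mono (by omega)
  set T := (range k).filter (fun j => ¬ H.Adj (w j) (w (j + 1))) with hT
  have hTpos : 0 < #T := card_pos.mpr ⟨0, by simp [hT, hk0, hfirst]⟩
  set S := T.image (fun j => s(w j, w (j + 1))) with hS
  set K := H ⊔ SimpleGraph.fromEdgeSet (S : Set (Sym2 V)) with hK
  have hHK : H ≤ K := le_sup_left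
  have hKG : K ≤ G := by
    refine sup_le hHG ?_
    intro x y hxy
    rw [SimpleGraph.fromEdgeSet_adj] at hxy
    have := hxy.1
    simp only [hS, coe_image, Set.mem_image, mem_coe, hT, mem_filter, mem_range] at this
    obtain ⟨j, ⟨hj, -⟩, he⟩ := this
    rw [← SimpleGraph.mem_edgeSet, ← he]
    exact hw j hj
  have hE : K.edgeSet.ncard ≤ H.edgeSet.ncard + #T :=
    (edge_bound H S).trans (by gcongr; exact card_image_le)
  have hKw : ∀ j < k, K.Adj (w j) (w (j + 1)) := by
    intro j hj
    rw [hK, SimpleGraph.sup_adj]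
    by_cases h : H.Adj (w j) (w (j + 1))
    · exact Or.inl h
    · right
      rw [SimpleGraph.fromEdgeSet_adj]
      refine ⟨?_, (hw j hj).ne⟩
      rw [mem_coe, hS]
      exact mem_image.mpr ⟨j, by simp [hT, hj, h], rfl⟩
  have hKui : ∀ i ≤ k, R K i u (w i) := fun i hi => by
    have := R.path hKw 0 i (by omega)
    rwa [hw0, zero_add] at this
  have hKiv : ∀ i ≤ k, R K (k - i) (w i) v := fun i hi => by
    have := R.path hKw i (k - i) (by omega)
    rwa [show i + (k - i) = k by omega, hwk] at this
  -- degrees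
  have hdT : ∀ j ∈ T, D ≤ #(N H (w j)) := by
    intro j hj
    simp only [hT, mem_filter, mem_range] at hj
    exact deg_large hD hHG hmax (hw j hj.1) hj.2
  have hdu : D ≤ #(N H u) := by
    rw [← hw0]; exact deg_large hD hHG hmax (hw 0 hk0) hfirst
  have hdv : D ≤ #(N H v) := by
    rw [← hwk]
    have h1 := hw (k - 1) (by omega)
    rw [show k - 1 + 1 = k by omega] at h1
    exact deg_large hD hHG hmax h1.symm (fun h => hlast h.symm)
  -- the vertices near the path
  set Z := T.biUnion (fun j => N H (w j)) with hZ
  have hZcard : #T * D ≤ 3 * #Z := by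
    have h1 : #T * D ≤ ∑ j ∈ T, #(Z.filter (fun z => H.Adj (w j) z)) := by
      rw [← smul_eq_mul]
      refine card_nsmul_le_sum _ _ _ fun j hj => (hdT j hj).trans (card_le_card ?_)
      intro z hz
      refine mem_filter.mpr ⟨mem_biUnion.mpr ⟨j, hj, hz⟩, ?_⟩
      simpa [N] using hz
    have h2 : ∑ j ∈ T, #(Z.filter (fun z => H.Adj (w j) z)) =
        ∑ z ∈ Z, #(T.filter (fun j => H.Adj (w j) z)) :=
      sum_card_bipartiteAbove_eq_sum_card_bipartiteBelow (fun j z => H.Adj (w j) z)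
    have h3 : ∑ z ∈ Z, #(T.filter (fun j => H.Adj (w j) z)) ≤ #Z * 3 := by
      rw [← smul_eq_mul]
      refine sum_le_card_nsmul _ _ _ fun z _ => ?_
      rcases (T.filter (fun j => H.Adj (w j) z)).eq_empty_or_nonempty with he | hne
      · simp [he]
      · set m := (T.filter (fun j => H.Adj (w j) z)).min' hne with hm
        have hmm := min'_mem _ hne
        rw [← hm] at hmm
        have hsubs : T.filter (fun j => H.Adj (w j) z) ⊆ Icc m (m + 2) := by
          intro j hj
          have hmj : m ≤ j := min'_le _ _ hj
          simp only [hT, mem_filter, mem_range] at hj hmm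
          have hr := hlow _ ((((hui m hmm.1.1.le).trans (R.adj (hHG hmm.2))).trans
            (R.adj (hHG hj.2.symm))).trans (hiv j hj.1.1.le))
          rw [mem_Icc]
          omega
        refine (card_le_card hsubs).trans ?_
        rw [Nat.card_Icc]
        omega
    omega
  -- gain
  set Γ := Phi G K \ Phi G H with hΓ
  have hgain : #Z * D ≤ #Γ := by
    set P : Finset (V × V) := univ.filter (fun t => ∃ e : Fin 5, (t, e) ∈ Γ) with hP
    have hPΓ : #P ≤ #Γ := by
      refine (card_le_card (t := Γ.image Prod.fst) ?_).trans card_image_le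
      intro t ht
      obtain ⟨e, he⟩ := (mem_filter.mp ht).2
      exact mem_image.mpr ⟨_, he, rfl⟩
    refine le_trans ?_ hPΓ
    have key : ∀ (x z : V) (l : ℕ), (x, z) ∉ P → R K l x z → l ≤ G.dist x z + 4 → R H l x z := by
      intro x z l hx hr hl
      have h1 := (hr.le hKG).dist_le
      by_contra hno
      apply hx
      refine mem_filter.mpr ⟨mem_univ _, ⟨l - G.dist x z, by omega⟩, ?_⟩
      simp only [hΓ, Phi, mem_sdiff, mem_filter, mem_univ, true_and]
      rw [show G.dist x z + (l - G.dist x z) = l by omega]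
      exact ⟨hr, hno⟩
    have hz : ∀ z ∈ Z, D ≤ #(univ.filter (fun a => (a, z) ∈ P)) := by
      intro z hz
      obtain ⟨i, hi, hiz⟩ := mem_biUnion.mp hz
      replace hiz : H.Adj (w i) z := by simpa [N] using hiz
      have hik : i < k := by
        simp only [hT, mem_filter, mem_range] at hi
        exact hi.1
      have hxl : ∀ x, H.Adj u x → R K (i + 2) x z ∧ i + 2 ≤ G.dist x z + 4 := by
        intro x hx
        have h1 : R K (1 + i + 1) x z :=
          ((R.adj (hHK hx.symm)).trans (hKui i hik.le)).trans (R.adj (hHK hiz))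
        refine ⟨h1.mono (by omega), ?_⟩
        have h2 := R.of_reachable (h1.le hKG).reachable
        have := hlow _ ((((R.adj (hHG hx)).trans h2).trans (R.adj (hHG hiz.symm))).trans
          (hiv i hik.le))
        omega
      have hyl : ∀ y, H.Adj v y → R K (k - i + 2) y z ∧ k - i + 2 ≤ G.dist y z + 4 := by
        intro y hy
        have h1 : R K (1 + (k - i) + 1) y z :=
          ((R.adj (hHK hy.symm)).trans (hKiv i hik.le).symm).trans (R.adj (hHK hiz))
        refine ⟨h1.mono (by omega), ?_⟩
        have h2 := R.of_reachable (h1.le hKG).reachable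
        have := hlow _ ((((R.adj (hHG hy)).trans h2).trans (R.adj (hHG hiz.symm))).trans
          (hui i hik.le).symm).symm
        omega
      by_cases hX : ∀ x ∈ N H u, (x, z) ∈ P
      · exact hdu.trans (card_le_card fun x hx => mem_filter.mpr ⟨mem_univ _, hX x hx⟩)
      · by_cases hY : ∀ y ∈ N H v, (y, z) ∈ P
        · exact hdv.trans (card_le_card fun x hx => mem_filter.mpr ⟨mem_univ _, hY x hx⟩)
        · exfalso
          push Not at hX hY
          obtain ⟨x, hxN, hxP⟩ := hX
          obtain ⟨y, hyN, hyP⟩ := hY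
          replace hxN : H.Adj u x := by simpa [N] using hxN
          replace hyN : H.Adj v y := by simpa [N] using hyN
          have h1 := key x z _ hxP (hxl x hxN).1 (hxl x hxN).2
          have h2 := key y z _ hyP (hyl y hyN).1 (hyl y hyN).2
          exact hbad ((((R.adj hxN).trans h1).trans (h2.symm.trans (R.adj hyN.symm))).mono
            (by omega))
    calc #Z * D ≤ ∑ z ∈ Z, #(univ.filter (fun a => (a, z) ∈ P)) := by
          rw [← smul_eq_mul]
          exact card_nsmul_le_sum _ _ _ hz
      _ = #(Z.sigma (fun z => univ.filter (fun a => (a, z) ∈ P))) := (card_sigma _ _).symm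
      _ ≤ #P := by
          refine card_le_card_of_injOn (fun q => (q.2, q.1)) ?_ ?_
          · rintro ⟨z, a⟩ hq
            have := (mem_sigma.mp hq).2
            exact (mem_filter.mp this).2
          · rintro ⟨z, a⟩ _ ⟨z', a'⟩ _ h
            simp only [Prod.mk.injEq] at h
            obtain ⟨rfl, rfl⟩ := h
            rfl
  have hPhi : #(Phi G K) = #(Phi G H) + #Γ := by
    have : #Γ + #(Phi G H) = #(Phi G K) := by
      rw [hΓ]
      convert card_sdiff_add_card_eq_card (Phi_mono (G := G) hHK)
    omega
  have hSum : ∑ v, min D (#(N H v)) ≤ ∑ v, min D (#(N K v)) :=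
    sum_le_sum fun v _ => min_le_min le_rfl (card_le_card (N_mono hHK v))
  have h := hmax K hKG
  unfold Psi at h
  have hD2 : (0 : ℤ) < (D : ℤ) ^ 2 := by positivity
  have hfin : #T * D ^ 2 ≤ 3 * #Γ := by nlinarith
  have hpos : 0 < #T * D ^ 2 := by positivity
  have hfin' : #T * D ^ 2 < 4 * #Γ := by omega
  zify at hE hPhi hSum hfin'
  push_cast at h
  rw [hPhi] at h
  nlinarith [mul_le_mul_of_nonneg_left hE hD2.le, mul_le_mul_of_nonneg_left hSum hD2.le]

lemma exists_spanner (G : SimpleGraph V) (D : ℕ) (hD : 0 < D) : ∃ H ≤ G,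
    (∀ u v : V, G.Reachable u v → H.Reachable u v ∧ H.dist u v ≤ G.dist u v + 6) ∧
    D ^ 2 * H.edgeSet.ncard ≤ 2 * D ^ 2 * (Fintype.card V * D) + 20 * Fintype.card V ^ 2 := by
  classical
  obtain ⟨H, hHG, hmax⟩ := Set.exists_max_image {K : SimpleGraph V | K ≤ G} (Psi G D)
    (Set.toFinite _) ⟨⊥, (bot_le : ⊥ ≤ G)⟩
  refine ⟨H, hHG, fun u v huv => ?_, ?_⟩
  · have := spanner hD hHG hmax _ u v huv rfl
    exact ⟨this.reachable, this.dist_le⟩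
  · have h := hmax ⊥ (bot_le : ⊥ ≤ G)
    unfold Psi at h
    rw [SimpleGraph.edgeSet_bot, Set.ncard_empty] at h
    have h1 : ∑ v, min D (#(N H v)) ≤ Fintype.card V * D := by
      rw [← smul_eq_mul]
      exact sum_le_card_nsmul _ _ _ fun v _ => min_le_left _ _
    have h2 : #(Phi G H) ≤ 5 * Fintype.card V ^ 2 := by
      refine (card_le_univ _).trans ?_
      simp only [Fintype.card_prod, Fintype.card_fin]
      nlinarith
    have h0 : (0 : ℤ) ≤ 2 * (D : ℤ) ^ 2 * (∑ v, min D (#(N (⊥ : SimpleGraph V) v)) : ℕ) +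
      4 * (#(Phi G (⊥ : SimpleGraph V)) : ℤ) := by positivity
    zify at h1 h2 ⊢
    push_cast at h h0
    have hD2 : (0 : ℤ) < (D : ℤ) ^ 2 := by positivity
    nlinarith [mul_le_mul_of_nonneg_left h1 hD2.le]

end main

end Spanner

/-- There is an absolute constant `C` such that every simple graph `G` on `n` vertices
has a spanning subgraph `H ≤ G` which is an additive 6-spanner of `G`
(reachable pairs stay reachable and distances increase by at most 6)
with at most `C * n^(4/3)` edges. -/
theorem additive_six_spanner :
    ∃ C : ℝ, 0 < C ∧
      ∀ (V : Type) [Fintype V] (G : SimpleGraph V),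
        ∃ H : SimpleGraph V, H ≤ G ∧
          (∀ u v : V, G.Reachable u v →
            H.Reachable u v ∧ H.dist u v ≤ G.dist u v + 6) ∧
          (H.edgeSet.ncard : ℝ) ≤ C * (Fintype.card V : ℝ) ^ (4 / 3 : ℝ) := by
  refine ⟨24, by norm_num, ?_⟩
  intro V _ G
  rcases Nat.eq_zero_or_pos (Fintype.card V) with hn | hn
  · haveI : IsEmpty V := Fintype.card_eq_zero_iff.mp hn
    refine ⟨G, le_rfl, fun u => isEmptyElim u, ?_⟩
    have : G.edgeSet = ∅ := by
      rw [SimpleGraph.edgeSet_eq_empty]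
      exact Subsingleton.elim _ _
    rw [this, Set.ncard_empty]
    push_cast
    positivity
  · set n := Fintype.card V with hnV
    set c : ℝ := (n : ℝ) ^ (1 / 3 : ℝ) with hc
    have hn1 : (1 : ℝ) ≤ n := by exact_mod_cast hn
    have hc1 : 1 ≤ c := Real.one_le_rpow hn1 (by norm_num)
    have hc3 : c ^ 3 = n := by
      rw [hc, ← Real.rpow_natCast, ← Real.rpow_mul (by positivity)]
      norm_num
    have hc4 : (n : ℝ) ^ (4 / 3 : ℝ) = c ^ 4 := by
      rw [hc, ← Real.rpow_natCast, ← Real.rpow_mul (by positivity)]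
      norm_num
    have hD : 0 < ⌈c⌉₊ := Nat.ceil_pos.mpr (by linarith)
    obtain ⟨H, hHG, hsp, hE⟩ := Spanner.exists_spanner G ⌈c⌉₊ hD
    refine ⟨H, hHG, hsp, ?_⟩
    rw [hc4]
    have hDl : c ≤ (⌈c⌉₊ : ℝ) := Nat.le_ceil c
    have hDu : (⌈c⌉₊ : ℝ) ≤ 2 * c := by
      have := Nat.ceil_lt_add_one (show 0 ≤ c by linarith)
      linarith
    rw [← hnV] at hE
    have hE' : (⌈c⌉₊ : ℝ) ^ 2 * (H.edgeSet.ncard : ℝ) ≤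
        2 * (⌈c⌉₊ : ℝ) ^ 2 * (n * (⌈c⌉₊ : ℝ)) + 20 * (n : ℝ) ^ 2 := by exact_mod_cast hE
    rw [← hc3] at hE'
    set d : ℝ := (⌈c⌉₊ : ℝ) with hd
    have hd0 : 0 < d ^ 2 := by positivity
    have hcd : c ^ 2 ≤ d ^ 2 := by gcongr
    refine le_of_mul_le_mul_left (hE'.trans ?_) hd0
    have e1 : 2 * d ^ 2 * (c ^ 3 * d) ≤ 2 * d ^ 2 * (c ^ 3 * (2 * c)) := by gcongr
    have e2 : 20 * (c ^ 3) ^ 2 ≤ 20 * (d ^ 2 * c ^ 4) := by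
      have : (c ^ 3) ^ 2 = c ^ 2 * c ^ 4 := by ring
      rw [this]
      gcongr
    linarith
end

section
/- For every simple graph G on n vertices there exists a spanning subgraph H of G (a graph on the same vertex set with H ≤ G) such that (i) for every pair of vertices u, v that are reachable in G, u and v are reachable in H and d_H(u,v) ≤ d_G(u,v) + 2, and (ii) the number of edges of H is at most C · n^{3/2} for some absolute constant C independent of G and n. -/
theorem spn_parent {V : Type} (G : SimpleGraph V) (c v : V) (h : G.Reachable c v) (hne : v ≠ c) :
    ∃ w, G.Adj v w ∧ G.Reachable c w ∧ G.dist c w < G.dist c v := by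
  obtain ⟨p, hp⟩ := h.symm.exists_walk_length_eq_dist
  cases p with
  | nil => exact absurd rfl hne
  | @cons _ w _ hadj q =>
    refine ⟨w, hadj, ⟨q.reverse⟩, ?_⟩
    have h1 := SimpleGraph.dist_le q.reverse
    rw [SimpleGraph.dist_comm (u := c) (v := v), ← hp]
    simp at h1 ⊢
    omega

theorem spn_dom {V : Type} [Fintype V] (G : SimpleGraph V) (k : ℕ) (hk : 1 ≤ k) :
    ∃ D : Finset V, D.card * k ≤ Fintype.card V ∧
      ∀ u, {v | G.Adj u v ∧ ∀ c ∈ D, ¬ G.Adj c v}.ncard ≤ k := by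
  classical
  let N : Finset V → Finset V := fun D => Finset.univ.filter fun v => ∃ c ∈ D, G.Adj c v
  let S : Finset (Finset V) := Finset.univ.filter fun D => D.card * k ≤ (N D).card
  obtain ⟨D, hD, hmax⟩ := S.exists_max_image Finset.card ⟨∅, by simp [S]⟩
  have hD' : D.card * k ≤ (N D).card := by simpa [S] using hD
  refine ⟨D, hD'.trans (Finset.card_le_univ _), fun u => ?_⟩
  by_contra! hlt
  set A : Finset V := Finset.univ.filter fun v => G.Adj u v ∧ ∀ c ∈ D, ¬ G.Adj c v with hA
  have hAc : {v | G.Adj u v ∧ ∀ c ∈ D, ¬ G.Adj c v}.ncard = A.card := by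
    rw [← Set.ncard_coe_finset]; congr 1; ext; simp [hA]
  rw [hAc] at hlt
  have hu : u ∉ D := by
    intro hu
    obtain ⟨v, hv⟩ := Finset.card_pos.mp (by omega : 0 < A.card)
    simp only [hA, Finset.mem_filter] at hv
    exact hv.2.2 u hu hv.2.1
  have hdisj : Disjoint (N D) A := by
    rw [Finset.disjoint_left]
    intro v hv hv'
    simp only [N, hA, Finset.mem_filter] at hv hv'
    obtain ⟨c, hc, h⟩ := hv.2
    exact hv'.2.2 c hc h
  have hsub : N D ∪ A ⊆ N (insert u D) := by
    intro v hv
    simp only [N, hA, Finset.mem_union, Finset.mem_filter, Finset.mem_univ, true_and,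
      Finset.mem_insert] at hv ⊢
    rcases hv with ⟨c, hc, h⟩ | h
    · exact ⟨c, Or.inr hc, h⟩
    · exact ⟨u, Or.inl rfl, h.1⟩
  have hc := Finset.card_le_card hsub
  rw [Finset.card_union_of_disjoint hdisj] at hc
  have := hmax (insert u D) (by
    simp only [S, Finset.mem_filter, Finset.mem_univ, true_and]
    rw [Finset.card_insert_of_notMem hu, add_mul]
    omega)
  rw [Finset.card_insert_of_notMem hu] at this
  omega

theorem spn_main {V : Type} [Fintype V] (G : SimpleGraph V) (k : ℕ) (hk : 1 ≤ k) :
    ∃ (H : SimpleGraph V) (m : ℕ), H ≤ G ∧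
      (∀ u v : V, G.Reachable u v →
        H.Reachable u v ∧ H.dist u v ≤ G.dist u v + 2) ∧
      m * k ≤ Fintype.card V ∧
      H.edgeSet.ncard ≤ Fintype.card V * k + m * Fintype.card V := by
  classical
  obtain ⟨D, hDk, hD⟩ := spn_dom G k hk
  have hp : ∀ c v : V, ∃ w, G.Reachable c v → v ≠ c →
      G.Adj v w ∧ G.Reachable c w ∧ G.dist c w < G.dist c v := by
    intro c v
    by_cases h : G.Reachable c v ∧ v ≠ c
    · obtain ⟨w, hw⟩ := spn_parent G c v h.1 h.2
      exact ⟨w, fun _ _ => hw⟩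
    · exact ⟨c, fun h1 h2 => absurd ⟨h1, h2⟩ h⟩
  choose p hp using hp
  let B : V → Finset V := fun u => Finset.univ.filter fun v => G.Adj u v ∧ ∀ c ∈ D, ¬ G.Adj c v
  have hB : ∀ u, (B u).card ≤ k := by
    intro u
    refine le_trans (le_of_eq ?_) (hD u)
    rw [← Set.ncard_coe_finset]; congr 1; ext; simp [B]
  let E1 : Finset (Sym2 V) := Finset.univ.biUnion fun u => (B u).image fun v => s(u, v)
  let E2 : Finset (Sym2 V) := D.biUnion fun c => Finset.univ.image fun v => s(v, p c v)
  let H : SimpleGraph V := SimpleGraph.fromEdgeSet ((E1 ∪ E2 : Finset (Sym2 V)) : Set (Sym2 V)) ⊓ G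
  have hHG : H ≤ G := inf_le_right
  have hE1 : ∀ u v, G.Adj u v → (∀ c ∈ D, ¬ G.Adj c v) → H.Adj u v := by
    intro u v h h'
    refine ⟨?_, h⟩
    rw [SimpleGraph.fromEdgeSet_adj]
    refine ⟨?_, h.ne⟩
    rw [Finset.mem_coe, Finset.mem_union]
    left
    simp only [E1, Finset.mem_biUnion, Finset.mem_image]
    exact ⟨u, Finset.mem_univ _, v, by simp only [B, Finset.mem_filter]; exact ⟨Finset.mem_univ _, h, h'⟩, rfl⟩
  have hE2 : ∀ c ∈ D, ∀ v, G.Reachable c v → v ≠ c → H.Adj v (p c v) := by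
    intro c hc v h h'
    have ha := (hp c v h h').1
    refine ⟨?_, ha⟩
    rw [SimpleGraph.fromEdgeSet_adj]
    refine ⟨?_, ha.ne⟩
    rw [Finset.mem_coe, Finset.mem_union]
    right
    simp only [E2, Finset.mem_biUnion, Finset.mem_image]
    exact ⟨c, hc, v, Finset.mem_univ _, rfl⟩
  have hbfs : ∀ c ∈ D, ∀ (m : ℕ) (v : V), G.Reachable c v → G.dist c v = m →
      ∃ q : H.Walk v c, q.length ≤ m := by
    intro c hc m
    induction m using Nat.strong_induction_on with
    | _ m ih =>
      intro v hv hm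
      by_cases hvc : v = c
      · subst hvc; exact ⟨.nil, by simp⟩
      · obtain ⟨-, h2, h3⟩ := hp c v hv hvc
        obtain ⟨q, hq⟩ := ih _ (hm ▸ h3) _ h2 rfl
        exact ⟨.cons (hE2 c hc v hv hvc) q, by simp; omega⟩
  have hwalk : ∀ (u v : V) (w : G.Walk u v), (∃ q : H.Walk u v, q.length ≤ w.length) ∨
      ∃ x, (∃ c ∈ D, G.Adj c x) ∧ ∃ (w1 : G.Walk u x) (w2 : G.Walk x v),
        w1.length + w2.length ≤ w.length := by
    intro u v w
    induction w with
    | nil => exact Or.inl ⟨.nil, by simp⟩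
    | @cons a b d h w ih =>
      by_cases ha : ∃ c ∈ D, G.Adj c a
      · exact Or.inr ⟨a, ha, .nil, .cons h w, by simp⟩
      · push Not at ha
        have hab : H.Adj a b := (hE1 b a h.symm ha).symm
        rcases ih with ⟨q, hq⟩ | ⟨x, hx, w1, w2, hw⟩
        · exact Or.inl ⟨.cons hab q, by simpa using hq⟩
        · exact Or.inr ⟨x, hx, .cons h w1, w2, by simp; omega⟩
  refine ⟨H, D.card, hHG, ?_, hDk, ?_⟩
  · intro u v huv
    obtain ⟨w, hw⟩ := huv.exists_walk_length_eq_dist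
    suffices ∃ q : H.Walk u v, q.length ≤ G.dist u v + 2 by
      obtain ⟨q, hq⟩ := this
      exact ⟨⟨q⟩, (SimpleGraph.dist_le q).trans hq⟩
    rcases hwalk u v w with ⟨q, hq⟩ | ⟨x, ⟨c, hc, hcx⟩, w1, w2, hl⟩
    · exact ⟨q, by omega⟩
    · let a : G.Walk c u := .cons hcx w1.reverse
      let b : G.Walk c v := .cons hcx w2
      obtain ⟨q1, hq1⟩ := hbfs c hc _ u ⟨a⟩ rfl
      obtain ⟨q2, hq2⟩ := hbfs c hc _ v ⟨b⟩ rfl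
      have h1 := SimpleGraph.dist_le a
      have h2 := SimpleGraph.dist_le b
      refine ⟨q1.append q2.reverse, ?_⟩
      simp [a, b] at h1 h2 ⊢
      omega
  · have hsub : H.edgeSet ⊆ ((E1 ∪ E2 : Finset (Sym2 V)) : Set (Sym2 V)) := by
      intro e
      induction e with
      | _ x y =>
        intro h
        exact ((SimpleGraph.fromEdgeSet_adj _).1 (SimpleGraph.mem_edgeSet _ |>.1 h).1).1
    refine (Set.ncard_le_ncard hsub (Finset.finite_toSet _)).trans ?_
    rw [Set.ncard_coe_finset]
    refine (Finset.card_union_le _ _).trans (add_le_add ?_ ?_)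
    · exact Finset.card_biUnion_le_card_mul _ _ _ fun u _ => Finset.card_image_le.trans (hB u)
    · exact Finset.card_biUnion_le_card_mul _ _ _ fun u _ => Finset.card_image_le

/-- There is an absolute constant `C` such that every simple graph `G` on `n` vertices
has a spanning subgraph `H ≤ G` which is an additive 2-spanner of `G`
(reachable pairs stay reachable and distances increase by at most 2)
with at most `C * n^(3/2)` edges. -/
theorem additive_two_spanner :
    ∃ C : ℝ, 0 < C ∧
      ∀ (V : Type) [Fintype V] (G : SimpleGraph V),
        ∃ H : SimpleGraph V, H ≤ G ∧
          (∀ u v : V, G.Reachable u v →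
            H.Reachable u v ∧ H.dist u v ≤ G.dist u v + 2) ∧
          (H.edgeSet.ncard : ℝ) ≤ C * (Fintype.card V : ℝ) ^ (3 / 2 : ℝ) := by
  refine ⟨3, by norm_num, ?_⟩
  intro V _ G
  obtain ⟨H, m, h1, h2, h3, h4⟩ := spn_main G (Nat.sqrt (Fintype.card V) + 1) (by omega)
  refine ⟨H, h1, h2, ?_⟩
  generalize Fintype.card V = n at *
  have hs := Nat.sqrt_le n
  have hs2 := Nat.sqrt_lt_self (n := n)
  have hs3 := Nat.lt_succ_sqrt n
  set s := Nat.sqrt n with hsdef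
  have hms : m ≤ s := by
    by_contra! h
    have : (s + 1) * (s + 1) ≤ m * (s + 1) := Nat.mul_le_mul_right _ h
    simp only [Nat.succ_eq_add_one] at hs3
    omega
  rcases Nat.eq_zero_or_pos n with hn | hn
  · subst hn
    have : H.edgeSet.ncard = 0 := by simpa using h4
    rw [this]
    simp
  have hs1 : 1 ≤ s := Nat.sqrt_pos.2 hn
  have h5 : H.edgeSet.ncard ≤ 3 * (n * s) := by
    have : m * n ≤ s * n := Nat.mul_le_mul_right _ hms
    nlinarith
  have h6 : (n : ℝ) ^ (3 / 2 : ℝ) = n * Real.sqrt n := by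
    rw [Real.sqrt_eq_rpow, show (3 / 2 : ℝ) = 1 + 1 / 2 by norm_num,
      Real.rpow_add (by exact_mod_cast hn), Real.rpow_one]
  have h7 : (s : ℝ) ≤ Real.sqrt n := Real.le_sqrt_of_sq_le (by rw [sq]; exact_mod_cast hs)
  have h8 : (H.edgeSet.ncard : ℝ) ≤ 3 * (n * s) := by exact_mod_cast h5
  rw [h6]
  refine h8.trans ?_
  gcongr
end

section
/- Let G be a simple graph, let p be a path from u to v in G whose length equals d_G(u,v) (a shortest path), and let H be a spanning subgraph of G (H ≤ G). Then 3 times the number of vertices z of G that are adjacent in H to at least one vertex of p is at least the sum over all vertices w of p of the degree deg_H(w) of w in H. -/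
theorem aux_idx {V : Type*} (G : SimpleGraph V) {u v : V} (p : G.Walk u v)
    (hlen : p.length = G.dist u v) (z : V) (i j : ℕ) (hj : j ≤ p.length)
    (h1 : G.Adj z (p.getVert i)) (h2 : G.Adj z (p.getVert j)) : j ≤ i + 2 := by
  have := G.dist_le ((p.take i).append (.cons h1.symm (.cons h2 (p.drop j))))
  simp [SimpleGraph.Walk.take_length, SimpleGraph.Walk.drop_length] at this
  omega

theorem aux_card {V : Type*} [DecidableEq V] (G H : SimpleGraph V) [DecidableRel H.Adj]
    (hHG : H ≤ G) {u v : V} (p : G.Walk u v) (hlen : p.length = G.dist u v) (z : V) :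
    (p.support.toFinset.filter (fun w => H.Adj z w)).card ≤ 3 := by
  by_cases hne : ∃ i, i ≤ p.length ∧ H.Adj z (p.getVert i)
  · classical
    have hs := Nat.find_spec hne
    set i := Nat.find hne with hi
    have hsub : p.support.toFinset.filter (fun w => H.Adj z w) ⊆
        (Finset.Icc i (i+2)).image p.getVert := by
      intro w hw
      simp only [Finset.mem_filter, List.mem_toFinset] at hw
      obtain ⟨j, rfl, hj⟩ := SimpleGraph.Walk.mem_support_iff_exists_getVert.1 hw.1
      refine Finset.mem_image.2 ⟨j, Finset.mem_Icc.2 ⟨Nat.find_min' hne ⟨hj, hw.2⟩, ?_⟩, rfl⟩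
      exact aux_idx G p hlen z i j hj (hHG hs.2) (hHG hw.2)
    refine (Finset.card_le_card hsub).trans (Finset.card_image_le.trans ?_)
    simp
    omega
  · rw [Finset.filter_false_of_mem]
    · simp
    · intro w hw h
      obtain ⟨j, rfl, hj⟩ := SimpleGraph.Walk.mem_support_iff_exists_getVert.1
        (List.mem_toFinset.1 hw)
      exact hne ⟨j, hj, h⟩

/-- Let `p` be a shortest path in `G` and `H ≤ G` a spanning subgraph. Then three
times the number of vertices adjacent in `H` to some vertex of `p` is at least the
sum of the `H`-degrees of the vertices of `p`. -/
theorem three_times_neighbors_ge_degree_sum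
    {V : Type*} [Fintype V] (G H : SimpleGraph V) [DecidableRel H.Adj]
    (hHG : H ≤ G)
    {u v : V} (p : G.Walk u v) (hp : p.IsPath) (hlen : p.length = G.dist u v) :
    (p.support.map (fun w => H.degree w)).sum ≤
      3 * {z : V | ∃ w ∈ p.support, H.Adj z w}.ncard := by
  classical
  rw [← List.sum_toFinset _ hp.support_nodup]
  have hN : {z : V | ∃ w ∈ p.support, H.Adj z w}.ncard =
      (Finset.univ.filter (fun z => ∃ w ∈ p.support, H.Adj z w)).card := by
    rw [← Set.ncard_coe_finset]; simp
  rw [hN]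
  set N := Finset.univ.filter (fun z => ∃ w ∈ p.support, H.Adj z w) with hNd
  calc ∑ w ∈ p.support.toFinset, H.degree w
      = ∑ w ∈ p.support.toFinset, (N.filter (fun z => H.Adj z w)).card := by
        refine Finset.sum_congr rfl fun w hw => ?_
        rw [← SimpleGraph.card_neighborFinset_eq_degree]
        congr 1
        ext z
        simp only [SimpleGraph.mem_neighborFinset, hNd, Finset.mem_filter, Finset.mem_univ,
          true_and]
        exact ⟨fun h => ⟨⟨w, List.mem_toFinset.1 hw, h.symm⟩, h.symm⟩, fun h => h.2.symm⟩
    _ = ∑ z ∈ N, (p.support.toFinset.filter (fun w => H.Adj z w)).card :=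
        (Finset.sum_card_bipartiteAbove_eq_sum_card_bipartiteBelow (fun z w => H.Adj z w)).symm
    _ ≤ ∑ z ∈ N, 3 := Finset.sum_le_sum fun z _ => aux_card G H hHG p hlen z
    _ = 3 * N.card := by simp [mul_comm]
end

section
/- Let G be a simple graph, let p be a path from u to v in G whose length equals d_G(u,v), and let H be a spanning subgraph of G (H ≤ G) containing every edge of p. If z is a vertex adjacent in H to some vertex w lying on p, then d_H(u,z) ≤ d_G(u,z) + 2 and d_H(z,v) ≤ d_G(z,v) + 2. -/
/-- Let `p` be a shortest path from `u` to `v` in `G`, and `H ≤ G` a spanning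
subgraph containing every edge of `p`. If `z` is adjacent in `H` to some vertex `w`
on `p`, then `d_H(u,z) ≤ d_G(u,z) + 2` and `d_H(z,v) ≤ d_G(z,v) + 2`. -/
theorem neighbor_of_shortest_path_dist_le
    {V : Type*} (G H : SimpleGraph V) (hHG : H ≤ G)
    {u v : V} (p : G.Walk u v) (hp : p.IsPath) (hlen : p.length = G.dist u v)
    (hpH : ∀ e ∈ p.edges, e ∈ H.edgeSet)
    (z w : V) (hw : w ∈ p.support) (hzw : H.Adj z w) :
    H.dist u z ≤ G.dist u z + 2 ∧ H.dist z v ≤ G.dist z v + 2 := by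
  obtain ⟨q, r, rfl⟩ := SimpleGraph.Walk.mem_support_iff_exists_append.1 hw
  have hG : G.Adj z w := hHG hzw
  have hq : ∀ e ∈ q.edges, e ∈ H.edgeSet := fun e he => hpH e (by simp [he])
  have hr : ∀ e ∈ r.edges, e ∈ H.edgeSet := fun e he => hpH e (by simp [he])
  have h1 := SimpleGraph.dist_le ((q.transfer H hq).concat hzw.symm)
  have h2 := SimpleGraph.dist_le (SimpleGraph.Walk.cons hzw (r.transfer H hr))
  obtain ⟨a, ha⟩ := (q.concat hG.symm).reachable.exists_walk_length_eq_dist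
  obtain ⟨b, hb⟩ := (SimpleGraph.Walk.cons hG r).reachable.exists_walk_length_eq_dist
  have h3 := SimpleGraph.dist_le (a.append (SimpleGraph.Walk.cons hG r))
  have h4 := SimpleGraph.dist_le ((q.concat hG.symm).append b)
  simp only [SimpleGraph.Walk.length_append, SimpleGraph.Walk.length_cons,
    SimpleGraph.Walk.length_concat, SimpleGraph.Walk.length_transfer] at *
  omega
end

section
/- Let G be a simple graph, let u, v be vertices with ed_{H_0}(u,v) > d_G(u,v) + 2 for a spanning subgraph H_0 ≤ G (where ed denotes the extended distance in ℕ∞, equal to ∞ for unreachable pairs), let p be a path from u to v in G whose length equals d_G(u,v), and let H be the spanning subgraph whose edge set is the union of the edges of H_0 and the edges of p. Then for every vertex z adjacent in H to some vertex of p: (i) ed_H(u,z) + ed_H(z,v) ≤ d_G(u,v) + 2, and (ii) ed_H(u,z) < ed_{H_0}(u,z) or ed_H(z,v) < ed_{H_0}(z,v). -/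
/-- Suppose `ed_{H₀}(u,v) > d_G(u,v) + 2` for a spanning subgraph `H₀ ≤ G`, let `p`
be a shortest path from `u` to `v` in `G`, and let `H` be obtained from `H₀` by
adding the edges of `p`. Then for every vertex `z` adjacent in `H` to a vertex of
`p`: `ed_H(u,z) + ed_H(z,v) ≤ d_G(u,v) + 2`, and moreover `ed_H(u,z) < ed_{H₀}(u,z)`
or `ed_H(z,v) < ed_{H₀}(z,v)`. -/
theorem added_shortest_path_improves_neighbor
    {V : Type*} (G H₀ : SimpleGraph V) (hH₀G : H₀ ≤ G)
    {u v : V} (hviol : (G.dist u v : ℕ∞) + 2 < H₀.edist u v)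
    (p : G.Walk u v) (hp : p.IsPath) (hlen : p.length = G.dist u v)
    (H : SimpleGraph V) (hH : H = H₀ ⊔ SimpleGraph.fromEdgeSet {e | e ∈ p.edges})
    (z : V) (hz : ∃ w ∈ p.support, H.Adj z w) :
    H.edist u z + H.edist z v ≤ (G.dist u v : ℕ∞) + 2 ∧
      (H.edist u z < H₀.edist u z ∨ H.edist z v < H₀.edist z v) := by
  classical
  obtain ⟨w, hw, hadj⟩ := hz
  have hq : ∀ e ∈ p.edges, e ∈ H.edgeSet := by
    intro e he
    rw [hH, SimpleGraph.edgeSet_sup, SimpleGraph.edgeSet_fromEdgeSet]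
    exact Or.inr ⟨he, G.not_isDiag_of_mem_edgeSet (p.edges_subset_edgeSet he)⟩
  have hw' : w ∈ (p.transfer H hq).support := by simpa using hw
  have hl : ((p.transfer H hq).takeUntil w hw').length
      + ((p.transfer H hq).dropUntil w hw').length = G.dist u v := by
    rw [← SimpleGraph.Walk.length_append, SimpleGraph.Walk.take_spec,
      SimpleGraph.Walk.length_transfer, hlen]
  have h1 := SimpleGraph.edist_le ((p.transfer H hq).takeUntil w hw')
  have h2 := SimpleGraph.edist_le ((p.transfer H hq).dropUntil w hw')
  have h3 : H.edist z w = 1 := SimpleGraph.edist_eq_one_iff_adj.2 hadj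
  have h4 : H.edist w z = 1 := SimpleGraph.edist_eq_one_iff_adj.2 hadj.symm
  have key : H.edist u z + H.edist z v ≤ (G.dist u v : ℕ∞) + 2 := by
    calc H.edist u z + H.edist z v
        ≤ (H.edist u w + H.edist w z) + (H.edist z w + H.edist w v) :=
          add_le_add H.edist_triangle H.edist_triangle
      _ = (H.edist u w + H.edist w v) + 2 := by
          rw [h3, h4, ← one_add_one_eq_two]; ring
      _ ≤ (G.dist u v : ℕ∞) + 2 := by
          rw [← hl]; push_cast
          exact add_le_add_left (add_le_add h1 h2) 2
  refine ⟨key, ?_⟩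
  by_contra hcon
  rw [not_or, not_lt, not_lt] at hcon
  exact absurd (hviol.trans_le (H₀.edist_triangle (v := z))) 
    (not_lt.2 ((add_le_add hcon.1 hcon.2).trans key))
end

section
/- Let G be a simple graph and H_0 ≤ G a spanning subgraph. Let p be a path from u to v in G with vertex sequence w_0 = u, …, w_t = v whose length t equals d_G(u,v), and let H be the spanning subgraph whose edge set is the union of the edges of H_0 and the edges of p. Let i ≤ k ≤ j be indices, let z be adjacent to w_i in H_0, let w be adjacent to w_j in H_0, and let r be adjacent in H to w_k. If ed_{H_0}(w_i, w_j) > d_G(w_i, w_j) + 6, then ed_H(z,r) < ed_{H_0}(z,r) or ed_H(r,w) < ed_{H_0}(r,w), where ed denotes extended distance in ℕ∞. -/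
/-- Let `H₀ ≤ G`, let `p` be a shortest path `w₀ = u, …, w_t = v` in `G`, and let
`H` be obtained from `H₀` by adding the edges of `p`. For indices `i ≤ k ≤ j ≤ t`,
if `z` is adjacent to `wᵢ` in `H₀`, `w` is adjacent to `wⱼ` in `H₀`, `r` is adjacent
in `H` to `w_k`, and `ed_{H₀}(wᵢ,wⱼ) > d_G(wᵢ,wⱼ) + 6`, then
`ed_H(z,r) < ed_{H₀}(z,r)` or `ed_H(r,w) < ed_{H₀}(r,w)`. -/
theorem added_path_improves_some_edist
    {V : Type*} (G H₀ : SimpleGraph V) (hH₀G : H₀ ≤ G)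
    {u v : V} (p : G.Walk u v) (hp : p.IsPath) (hlen : p.length = G.dist u v)
    (H : SimpleGraph V) (hH : H = H₀ ⊔ SimpleGraph.fromEdgeSet {e | e ∈ p.edges})
    (i k j : ℕ) (hik : i ≤ k) (hkj : k ≤ j) (hj : j ≤ p.length)
    (z w r : V)
    (hz : H₀.Adj z (p.getVert i)) (hw : H₀.Adj w (p.getVert j))
    (hr : H.Adj r (p.getVert k))
    (hviol : (G.dist (p.getVert i) (p.getVert j) : ℕ∞) + 6 <
      H₀.edist (p.getVert i) (p.getVert j)) :
    H.edist z r < H₀.edist z r ∨ H.edist r w < H₀.edist r w := by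
  -- consecutive vertices
  have hadj : ∀ n, n < p.length → H.Adj (p.getVert n) (p.getVert (n+1)) := by
    intro n hn
    subst hH
    rw [SimpleGraph.sup_adj, SimpleGraph.fromEdgeSet_adj]
    right
    refine ⟨?_, (p.adj_getVert_succ hn).ne⟩
    clear * - hn
    induction p generalizing n with
    | nil => simp at hn
    | cons h q ih =>
      cases n with
      | zero => simp
      | succ n =>
        have := ih n (by simpa using hn)
        simp only [Set.mem_setOf_eq] at this
        simp [this]
  have hseg : ∀ a n, a + n ≤ p.length → H.edist (p.getVert a) (p.getVert (a+n)) ≤ (n : ℕ∞) := by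
    intro a n
    induction n with
    | zero => intro _; simp
    | succ n ih =>
      intro h
      have h1 := ih (by omega)
      have h2 := SimpleGraph.edist_le (hadj (a+n) (by omega)).toWalk
      refine (SimpleGraph.edist_triangle (v := p.getVert (a+n))).trans ?_
      push_cast
      exact add_le_add h1 (by simpa [add_assoc] using h2)
  have hle : H₀ ≤ H := by rw [hH]; exact le_sup_left
  have one : ∀ {K : SimpleGraph V} {a b : V}, K.Adj a b → K.edist a b ≤ 1 := by
    intro K a b h
    simpa using SimpleGraph.edist_le h.toWalk
  have hd : j - i ≤ G.dist (p.getVert i) (p.getVert j) := by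
    have hreach : G.Reachable (p.getVert i) (p.getVert j) :=
      ((p.take i).reachable.symm).trans (p.take j).reachable
    obtain ⟨q, hq⟩ := hreach.exists_walk_length_eq_dist
    have h := SimpleGraph.dist_le ((p.take i).append (q.append (p.drop j)))
    simp only [SimpleGraph.Walk.length_append, SimpleGraph.Walk.take_length,
      SimpleGraph.Walk.drop_length] at h
    omega
  by_contra hcon
  push Not at hcon
  obtain ⟨h1, h2⟩ := hcon
  obtain ⟨a, rfl⟩ := Nat.exists_eq_add_of_le hik
  obtain ⟨b, rfl⟩ := Nat.exists_eq_add_of_le hkj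
  have s1 := hseg i a (by omega)
  have s2 := hseg (i+a) b (by omega)
  have e1 : H.edist z r ≤ 1 + (a + 1) :=
    (SimpleGraph.edist_triangle (v := p.getVert i)).trans (add_le_add (one (hle hz))
      ((SimpleGraph.edist_triangle (v := p.getVert (i+a))).trans (add_le_add s1 (one hr.symm))))
  have e2 : H.edist r w ≤ 1 + (b + 1) :=
    (SimpleGraph.edist_triangle (v := p.getVert (i+a))).trans (add_le_add (one hr)
      ((SimpleGraph.edist_triangle (v := p.getVert (i+a+b))).trans
        (add_le_add s2 (one (hle hw.symm)))))
  have e3 : H₀.edist (p.getVert i) (p.getVert (i+a+b)) ≤ 1 + ((1 + (a+1)) + ((1 + (b+1)) + 1)) :=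
    (SimpleGraph.edist_triangle (v := z)).trans (add_le_add (one hz.symm)
      ((SimpleGraph.edist_triangle (v := r)).trans (add_le_add (h1.trans e1)
        ((SimpleGraph.edist_triangle (v := w)).trans (add_le_add (h2.trans e2) (one hw))))))
  have e4 := hviol.trans_le e3
  have e5 : G.dist (p.getVert i) (p.getVert (i+a+b)) + 6 < 1 + ((1 + (a+1)) + ((1 + (b+1)) + 1)) := by
    exact_mod_cast e4
  omega
end

section
/- Let G be a simple graph, let p be a path from u to v in G with vertex sequence w_0 = u, …, w_t = v whose length t equals d_G(u,v), and let H be a spanning subgraph of G (H ≤ G) containing every edge of p. Let i ≤ k be indices, let z be a vertex adjacent in H to w_i and r a vertex adjacent in H to w_k. Then d_H(z,r) ≤ d_G(z,r) + 4. -/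
theorem aux_getVert_transfer {V : Type*} {G H : SimpleGraph V} {u v : V} (p : G.Walk u v)
    (hp : ∀ e ∈ p.edges, e ∈ H.edgeSet) (n : ℕ) :
    (p.transfer H hp).getVert n = p.getVert n := by
  induction p generalizing n with
  | nil => rfl
  | cons h p ih =>
    cases n with
    | zero => simp
    | succ n =>
      simp only [SimpleGraph.Walk.transfer, SimpleGraph.Walk.getVert_cons_succ]
      exact ih _ n


/-- Let `p` be a shortest path `w₀ = u, …, w_t = v` in `G` and `H ≤ G` a spanning
subgraph containing every edge of `p`. For indices `i ≤ k ≤ t`, if `z` is adjacent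
in `H` to `wᵢ` and `r` is adjacent in `H` to `w_k`, then
`d_H(z,r) ≤ d_G(z,r) + 4`. -/
theorem dist_neighbors_of_shortest_path_le
    {V : Type*} (G H : SimpleGraph V) (hHG : H ≤ G)
    {u v : V} (p : G.Walk u v) (hp : p.IsPath) (hlen : p.length = G.dist u v)
    (hpH : ∀ e ∈ p.edges, e ∈ H.edgeSet)
    (i k : ℕ) (hik : i ≤ k) (hk : k ≤ p.length)
    (z r : V)
    (hz : H.Adj z (p.getVert i)) (hr : H.Adj r (p.getVert k)) :
    H.dist z r ≤ G.dist z r + 4 := by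
  have hgv : ∀ n, (p.transfer H hpH).getVert n = p.getVert n := by
    intro n
    exact aux_getVert_transfer p hpH n
  have hend : ((p.transfer H hpH).drop i).getVert (k - i) = p.getVert k := by
    rw [SimpleGraph.Walk.drop_getVert, hgv]
    congr 1
    omega
  let q : H.Walk (p.getVert i) (p.getVert k) :=
    (((p.transfer H hpH).drop i).take (k - i)).copy (hgv i) hend
  have hq : q.length = k - i := by
    simp only [q, SimpleGraph.Walk.length_copy, SimpleGraph.Walk.take_length,
      SimpleGraph.Walk.drop_length, SimpleGraph.Walk.length_transfer]
    omega
  have h1 := SimpleGraph.dist_le (SimpleGraph.Walk.cons hz (q.concat hr.symm))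
  simp only [SimpleGraph.Walk.length_cons, SimpleGraph.Walk.length_concat, hq] at h1
  have hzr : G.Reachable z r :=
    (SimpleGraph.Walk.reachable (SimpleGraph.Walk.cons hz (q.concat hr.symm))).mono hHG
  obtain ⟨s, hs⟩ := hzr.exists_walk_length_eq_dist
  have h2 := SimpleGraph.dist_le
    ((p.take i).append ((SimpleGraph.Walk.cons (hHG hz).symm (s.concat (hHG hr))).append
      (p.drop k)))
  simp only [SimpleGraph.Walk.length_append, SimpleGraph.Walk.length_cons,
    SimpleGraph.Walk.length_concat, SimpleGraph.Walk.take_length,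
    SimpleGraph.Walk.drop_length] at h2
  omega
end

section
/- Let G be a simple graph and H_0 ≤ G a spanning subgraph. Let p be a path from u to v in G with vertex sequence w_0 = u, …, w_t = v whose length t equals d_G(u,v), and let 0 ≤ i ≤ j ≤ t. Suppose that for every index k with k < i or k > j, every edge of G incident to w_k is an edge of H_0. If ed_{H_0}(u,v) > d_G(u,v) + 6 then ed_{H_0}(w_i, w_j) > d_G(w_i, w_j) + 6, where ed denotes extended distance in ℕ∞. -/
theorem aux_edist_le_steps {V : Type*} (K : SimpleGraph V) (f : ℕ → V) (a n : ℕ)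
    (h : ∀ k, a ≤ k → k < a + n → K.Adj (f k) (f (k + 1))) :
    K.edist (f a) (f (a + n)) ≤ (n : ℕ∞) := by
  induction n with
  | zero => simp
  | succ n ih =>
    have h1 := ih (fun k hk hk' => h k hk (by omega))
    have h2 : K.edist (f (a + n)) (f (a + n + 1)) = 1 :=
      SimpleGraph.edist_eq_one_iff_adj.2 (h (a + n) (by omega) (by omega))
    calc K.edist (f a) (f (a + (n + 1)))
        ≤ K.edist (f a) (f (a + n)) + K.edist (f (a + n)) (f (a + n + 1)) :=
          SimpleGraph.edist_triangle
      _ ≤ (n : ℕ∞) + 1 := by rw [h2]; gcongr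
      _ = ((n + 1 : ℕ) : ℕ∞) := by push_cast; rfl

/-- Let `H₀ ≤ G` and let `p` be a shortest path `w₀ = u, …, w_t = v` in `G`, and
`0 ≤ i ≤ j ≤ t`. Suppose every edge of `G` incident to a vertex `w_k` with `k < i`
or `k > j` belongs to `H₀`. If `ed_{H₀}(u,v) > d_G(u,v) + 6` then
`ed_{H₀}(wᵢ,wⱼ) > d_G(wᵢ,wⱼ) + 6`. -/
theorem violation_transfers_to_inner_pair
    {V : Type*} (G H₀ : SimpleGraph V) (hH₀G : H₀ ≤ G)
    {u v : V} (p : G.Walk u v) (hp : p.IsPath) (hlen : p.length = G.dist u v)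
    (i j : ℕ) (hij : i ≤ j) (hj : j ≤ p.length)
    (hout : ∀ k ≤ p.length, (k < i ∨ j < k) →
      ∀ x : V, G.Adj (p.getVert k) x → H₀.Adj (p.getVert k) x)
    (hviol : (G.dist u v : ℕ∞) + 6 < H₀.edist u v) :
    (G.dist (p.getVert i) (p.getVert j) : ℕ∞) + 6 <
      H₀.edist (p.getVert i) (p.getVert j) := by
  by_contra! hc
  obtain ⟨m, rfl⟩ := Nat.exists_eq_add_of_le hij
  obtain ⟨r, hr⟩ := Nat.exists_eq_add_of_le hj
  have h1 : H₀.edist u (p.getVert i) ≤ (i : ℕ∞) := by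
    have := aux_edist_le_steps H₀ p.getVert 0 i (fun k _ hk =>
      hout k (by omega) (Or.inl (by omega)) _ (p.adj_getVert_succ (by omega)))
    simpa using this
  have h2 : G.edist (p.getVert i) (p.getVert (i + m)) ≤ (m : ℕ∞) :=
    aux_edist_le_steps G p.getVert i m (fun k _ hk => p.adj_getVert_succ (by omega))
  have h2' : (G.dist (p.getVert i) (p.getVert (i + m)) : ℕ∞) ≤ (m : ℕ∞) :=
    (ENat.coe_toNat_le_self _).trans h2
  have h3 : H₀.edist (p.getVert (i + m)) v ≤ (r : ℕ∞) := by
    have := aux_edist_le_steps H₀ p.getVert (i + m) r (fun k _ hk =>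
      (hout (k + 1) (by omega) (Or.inr (by omega)) _
        (p.adj_getVert_succ (by omega)).symm).symm)
    rwa [← hr, p.getVert_length] at this
  refine absurd hviol (not_lt.2 ?_)
  calc H₀.edist u v
      ≤ H₀.edist u (p.getVert i) + H₀.edist (p.getVert i) v := SimpleGraph.edist_triangle
    _ ≤ H₀.edist u (p.getVert i) + (H₀.edist (p.getVert i) (p.getVert (i + m))
          + H₀.edist (p.getVert (i + m)) v) := by
        gcongr; exact SimpleGraph.edist_triangle
    _ ≤ (i : ℕ∞) + (((m : ℕ∞) + 6) + r) := by
        gcongr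
        exact hc.trans (by gcongr)
    _ = (G.dist u v : ℕ∞) + 6 := by
        rw [← hlen, hr]; push_cast; ring
end

section
/- Let G be a simple graph, H_0 ≤ G a spanning subgraph, D a natural number, and p a path in G whose length equals the distance in G between its endpoints (a shortest path). Suppose that every vertex w on p with deg_{H_0}(w) < D has all of its G-incident edges contained in H_0. If exactly t ≥ 1 edges of p are not edges of H_0, then at least t + 1 vertices w on p satisfy deg_{H_0}(w) ≥ D. -/
theorem missing_edges_aux
    {V : Type*} [Fintype V] [DecidableEq V] (G H₀ : SimpleGraph V)
    [DecidableRel H₀.Adj] (D : ℕ)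
    {u v : V} (p : G.Walk u v)
    (hlow : ∀ w ∈ p.support, H₀.degree w < D →
      ∀ x : V, G.Adj w x → H₀.Adj w x)
    (ht : 1 ≤ (p.edges.filter (fun e => e ∉ H₀.edgeSet)).length) :
    (p.edges.filter (fun e => e ∉ H₀.edgeSet)).length + 1
      ≤ (p.support.filter (fun w => D ≤ H₀.degree w)).length := by
  induction p with
  | nil => simp at ht
  | @cons a b c h q ih =>
    have ih' := ih (fun w hw => hlow w (by simp [hw]))
    rw [SimpleGraph.Walk.edges_cons, List.filter_cons] at ht ⊢
    rw [SimpleGraph.Walk.support_cons, List.filter_cons]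
    by_cases hab : H₀.Adj a b
    · have h1 : ¬ (s(a, b) ∉ H₀.edgeSet) := by simpa using hab
      simp only [h1, decide_false, Bool.false_eq_true, if_false] at ht ⊢
      have := ih' ht
      split_ifs
      · rw [List.length_cons]; omega
      · exact this
    · have h1 : s(a, b) ∉ H₀.edgeSet := by simpa using hab
      have ha : D ≤ H₀.degree a := by
        by_contra hc
        exact hab (hlow a (by simp) (by omega) b h)
      have hb : D ≤ H₀.degree b := by
        by_contra hc
        exact hab (hlow b (by simp) (by omega) a h.symm).symm
      have hpos : 0 < (q.support.filter (fun w => D ≤ H₀.degree w)).length :=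
        List.length_pos_of_mem (a := b) (by simp [hb])
      rw [if_pos (by simpa using h1), if_pos (by simpa using ha), List.length_cons,
        List.length_cons]
      by_cases hq : 1 ≤ (q.edges.filter (fun e => e ∉ H₀.edgeSet)).length
      · have := ih' hq
        omega
      · omega

/-- Let `H₀ ≤ G`, `D : ℕ`, and let `p` be a shortest path in `G`. Suppose every
vertex `w` on `p` with `deg_{H₀} w < D` has all of its `G`-incident edges in `H₀`.
If exactly `t ≥ 1` edges of `p` are not edges of `H₀`, then at least `t + 1`
vertices `w` on `p` satisfy `deg_{H₀} w ≥ D`. -/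
theorem missing_edges_give_high_degree_vertices
    {V : Type*} [Fintype V] [DecidableEq V] (G H₀ : SimpleGraph V)
    [DecidableRel H₀.Adj] (hH₀G : H₀ ≤ G) (D : ℕ)
    {u v : V} (p : G.Walk u v) (hp : p.IsPath) (hlen : p.length = G.dist u v)
    (hlow : ∀ w ∈ p.support, H₀.degree w < D →
      ∀ x : V, G.Adj w x → H₀.Adj w x)
    (t : ℕ) (ht : 1 ≤ t)
    (hmiss : (p.edges.filter (fun e => e ∉ H₀.edgeSet)).length = t) :
    t + 1 ≤ (p.support.filter (fun w => D ≤ H₀.degree w)).length := by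
  subst hmiss
  exact missing_edges_aux G H₀ D p hlow ht
end

section
/- Let G be a simple graph on vertex set V, and for a spanning subgraph H ≤ G define the potential v(H) = Σ_{(u,w) ∈ V × V} max{0, d_G(u,w) − ed_H(u,w) + 3} (each summand interpreted in ℕ, being 0 whenever ed_H(u,w) = ∞) and the cost c(H) = Σ_{x ∈ V} (deg_H(x))². Let H_0 ≤ G, let u, v satisfy ed_{H_0}(u,v) > d_G(u,v) + 2, let p be a path from u to v in G whose length equals d_G(u,v), and let H be the spanning subgraph whose edge set is the union of the edges of H_0 and the edges of p. Then c(H) − c(H_0) ≤ 12 · (v(H) − v(H_0)). -/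
open SimpleGraph in
/-- The cost `c(H) = Σ_x (deg_H x)²` of a spanning subgraph `H ≤ G`. -/
def spannerCost {V : Type*} [Fintype V] (H : SimpleGraph V)
    [DecidableRel H.Adj] : ℕ :=
  ∑ x : V, H.degree x ^ 2

open SimpleGraph in
/-- The potential `v(H) = Σ_{(u,w)} max{0, d_G(u,w) − ed_H(u,w) + 3}` of a spanning
subgraph `H ≤ G`, each summand interpreted in `ℕ` (it is `0` when
`ed_H(u,w) = ∞`, since in `ℕ∞` we have `a - ⊤ = 0`). -/
noncomputable def spannerPotential {V : Type*} [Fintype V]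
    (G H : SimpleGraph V) : ℕ :=
  ∑ q : V × V, ((G.dist q.1 q.2 : ℕ∞) + 3 - H.edist q.1 q.2).toNat


theorem term_aux (d : ℕ) (a a0 : ℕ∞) (h : a ≤ a0) :
    ((d : ℕ∞) + 3 - a0).toNat ≤ ((d : ℕ∞) + 3 - a).toNat := by
  apply ENat.toNat_le_toNat
  · exact tsub_le_tsub_left h _
  · exact ne_top_of_le_ne_top (by exact ENat.coe_ne_top (d+3)) tsub_le_self

theorem term_top (d : ℕ) : ((d : ℕ∞) + 3 - ⊤).toNat = 0 := by simp

theorem term_coe (d a : ℕ) : ((d : ℕ∞) + 3 - (a : ℕ∞)).toNat = d + 3 - a := by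
  have : ((d : ℕ∞) + 3 - (a : ℕ∞)) = ((d + 3 - a : ℕ) : ℕ∞) := by push_cast; rfl
  rw [this, ENat.toNat_coe]

theorem improve_aux (d1 d2 i j l : ℕ) (a b a0 b0 : ℕ∞) (hl : i + j = l)
    (ha : a ≤ (i : ℕ∞) + 1) (hb : b ≤ (j : ℕ∞) + 1) (h1 : i ≤ d1 + 1) (h2 : j ≤ d2 + 1)
    (haa : a ≤ a0) (hbb : b ≤ b0) (h0 : (l : ℕ∞) + 2 < a0 + b0) :
    ((d1 : ℕ∞) + 3 - a0).toNat + ((d2 : ℕ∞) + 3 - b0).toNat + 1 ≤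
      ((d1 : ℕ∞) + 3 - a).toNat + ((d2 : ℕ∞) + 3 - b).toNat := by
  have hat : a ≠ ⊤ := ne_top_of_le_ne_top (ENat.coe_ne_top (i+1)) (by exact_mod_cast ha)
  have hbt : b ≠ ⊤ := ne_top_of_le_ne_top (ENat.coe_ne_top (j+1)) (by exact_mod_cast hb)
  lift a to ℕ using hat
  lift b to ℕ using hbt
  have ha' : a ≤ i + 1 := by exact_mod_cast ha
  have hb' : b ≤ j + 1 := by exact_mod_cast hb
  have m1 := term_aux d1 _ _ haa
  have m2 := term_aux d2 _ _ hbb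
  rw [term_coe] at m1 m2
  rw [term_coe, term_coe]
  by_cases t1 : a0 = ⊤
  · subst t1; rw [term_top]; omega
  by_cases t2 : b0 = ⊤
  · subst t2; rw [term_top]; omega
  lift a0 to ℕ using t1
  lift b0 to ℕ using t2
  have h0' : l + 2 < a0 + b0 := by exact_mod_cast h0
  have haa' : a ≤ a0 := by exact_mod_cast haa
  have hbb' : b ≤ b0 := by exact_mod_cast hbb
  rw [term_coe, term_coe]
  omega

/-- Amortization step of the 2-spanner completion: if `ed_{H₀}(u,v) > d_G(u,v) + 2`,
`p` is a shortest `u`–`v` path of `G`, and `H` is `H₀` with the edges of `p` added,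
then `c(H) − c(H₀) ≤ 12 · (v(H) − v(H₀))`. -/
theorem cost_increase_le_twelve_potential_increase
    {V : Type*} [Fintype V] (G H₀ : SimpleGraph V) [DecidableRel H₀.Adj]
    (hH₀G : H₀ ≤ G)
    {u v : V} (hviol : (G.dist u v : ℕ∞) + 2 < H₀.edist u v)
    (p : G.Walk u v) (hp : p.IsPath) (hlen : p.length = G.dist u v)
    (H : SimpleGraph V) [DecidableRel H.Adj]
    (hH : H = H₀ ⊔ SimpleGraph.fromEdgeSet {e | e ∈ p.edges}) :
    (spannerCost H : ℤ) - spannerCost H₀ ≤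
      12 * ((spannerPotential G H : ℤ) - spannerPotential G H₀) := by
  classical
  have hH₀H : H₀ ≤ H := hH ▸ le_sup_left
  have hadj : ∀ x y, H.Adj x y ↔ H₀.Adj x y ∨ (s(x, y) ∈ p.edges ∧ x ≠ y) := by
    intro x y; subst hH; simp
  have hHG : H ≤ G := by
    intro x y h
    rcases (hadj x y).1 h with h | h
    · exact hH₀G h
    · exact p.adj_of_mem_edges h.1
  have hedge : ∀ e ∈ p.edges, e ∈ H.edgeSet := by
    intro e he
    induction e with
    | h x y =>
      exact (hadj x y).2 (Or.inr ⟨he, (p.adj_of_mem_edges he).ne⟩)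
  have huv : u ≠ v := by
    rintro rfl
    simp at hviol
  -- facts on support vertices
  have hsup : ∀ x (hx : x ∈ p.support), (p.takeUntil x hx).length = G.dist u x ∧
      (p.dropUntil x hx).length = G.dist x v ∧ G.dist u x + G.dist x v = G.dist u v := by
    intro x hx
    have h1 := congrArg SimpleGraph.Walk.length (p.take_spec hx)
    rw [SimpleGraph.Walk.length_append] at h1
    have h2 := SimpleGraph.dist_le (p.takeUntil x hx)
    have h3 := SimpleGraph.dist_le (p.dropUntil x hx)
    have h4 := SimpleGraph.dist_le
      ((p.takeUntil x hx).reachable.exists_walk_length_eq_dist.choose.append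
        (p.dropUntil x hx).reachable.exists_walk_length_eq_dist.choose)
    rw [SimpleGraph.Walk.length_append,
      (p.takeUntil x hx).reachable.exists_walk_length_eq_dist.choose_spec,
      (p.dropUntil x hx).reachable.exists_walk_length_eq_dist.choose_spec] at h4
    omega
  have hinj : ∀ x ∈ p.support, ∀ y ∈ p.support, G.dist u x = G.dist u y → x = y := by
    intro x hx y hy h
    have h1 := SimpleGraph.Walk.getVert_length_takeUntil hx
    have h2 := SimpleGraph.Walk.getVert_length_takeUntil hy
    rw [(hsup x hx).1] at h1
    rw [(hsup y hy).1] at h2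
    rw [← h1, ← h2, h]
  -- adjacent distances
  have hd : ∀ x ∈ p.support, ∀ z, G.Adj x z → G.dist u x ≤ G.dist u z + 1 ∧
      G.dist u z ≤ G.dist u x + 1 ∧ G.dist x v ≤ G.dist v z + 1 := by
    intro x hx z hz
    have r1 : G.Reachable u x := (p.takeUntil x hx).reachable
    have r2 : G.Reachable v x := (p.dropUntil x hx).reachable.symm
    obtain ⟨w1, e1⟩ := r1.exists_walk_length_eq_dist
    obtain ⟨w2, e2⟩ := (r1.trans hz.reachable).exists_walk_length_eq_dist
    obtain ⟨w3, e3⟩ := (r2.trans hz.reachable).exists_walk_length_eq_dist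
    have f1 := SimpleGraph.dist_le (w1.concat hz)
    have f2 := SimpleGraph.dist_le (w2.concat hz.symm)
    have f3 := SimpleGraph.dist_le (w3.concat hz.symm)
    rw [SimpleGraph.dist_comm (u := v) (v := x)] at f3
    simp only [SimpleGraph.Walk.length_concat] at f1 f2 f3
    omega
  -- H distances
  have hHd : ∀ x ∈ p.support, H.edist u x ≤ G.dist u x ∧ H.edist v x ≤ G.dist x v := by
    intro x hx
    constructor
    · have := SimpleGraph.Walk.edist_le ((p.takeUntil x hx).transfer H
        (fun e he => hedge e (p.edges_takeUntil_subset hx he)))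
      rwa [SimpleGraph.Walk.length_transfer, (hsup x hx).1] at this
    · have := SimpleGraph.Walk.edist_le ((p.dropUntil x hx).transfer H
        (fun e he => hedge e (p.edges_dropUntil_subset hx he)))
      rwa [SimpleGraph.Walk.length_transfer, (hsup x hx).2.1, SimpleGraph.edist_comm] at this
  have hanti : ∀ a b, H.edist a b ≤ H₀.edist a b := fun a b =>
    SimpleGraph.edist_anti hH₀H
  set f : V → V → ℕ := fun a b => ((G.dist a b : ℕ∞) + 3 - H.edist a b).toNat with hf
  set f0 : V → V → ℕ := fun a b => ((G.dist a b : ℕ∞) + 3 - H₀.edist a b).toNat with hf0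
  have hmono : ∀ a b, f0 a b ≤ f a b := fun a b => term_aux _ _ _ (hanti a b)
  have himp : ∀ x ∈ p.support, ∀ z, H.Adj x z → f0 u z + f0 v z + 1 ≤ f u z + f v z := by
    intro x hx z hz
    have h1 := hd x hx z (hHG hz)
    have h2 := hHd x hx
    have h3 : H.edist x z ≤ 1 := (SimpleGraph.edist_eq_one_iff_adj.2 hz).le
    refine improve_aux _ _ (G.dist u x) (G.dist x v) (G.dist u v) _ _ _ _ (hsup x hx).2.2
      ?_ ?_ h1.1 h1.2.2 (hanti _ _) (hanti _ _) ?_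
    · exact SimpleGraph.edist_triangle.trans (add_le_add h2.1 h3)
    · exact SimpleGraph.edist_triangle.trans (add_le_add h2.2 h3)
    · refine hviol.trans_le ?_
      rw [SimpleGraph.edist_comm (u := v)]
      exact SimpleGraph.edist_triangle
  set S : Finset V := p.support.toFinset with hS
  set N : Finset V := Finset.univ.filter (fun z => ∃ x ∈ S, H.Adj x z) with hN
  have hpot : (N.card : ℤ) ≤ (spannerPotential G H : ℤ) - spannerPotential G H₀ := by
    have e1 : (spannerPotential G H : ℤ) - spannerPotential G H₀ =
        ∑ a, ∑ b, ((f a b : ℤ) - f0 a b) := by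
      unfold spannerPotential
      rw [Fintype.sum_prod_type, Fintype.sum_prod_type]
      push_cast
      simp only [← Finset.sum_sub_distrib]
      rfl
    have e2 : ∑ a ∈ {u, v}, ∑ b, ((f a b : ℤ) - f0 a b) ≤ ∑ a, ∑ b, ((f a b : ℤ) - f0 a b) := by
      apply Finset.sum_le_sum_of_subset_of_nonneg (Finset.subset_univ _)
      intro a _ _
      apply Finset.sum_nonneg
      intro b _
      have := hmono a b
      omega
    rw [Finset.sum_pair huv, ← Finset.sum_add_distrib] at e2
    rw [e1]
    refine le_trans ?_ e2
    rw [hN, Finset.card_filter]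
    push_cast
    apply Finset.sum_le_sum
    intro z _
    have m1 := hmono u z
    have m2 := hmono v z
    split_ifs with h
    · obtain ⟨x, hx, hxz⟩ := h
      have := himp x (by simpa [hS] using hx) z hxz
      omega
    · omega
  have hcount : ∑ x ∈ S, H.degree x ≤ 3 * N.card := by
    have e1 : ∑ x ∈ S, H.degree x = ∑ z ∈ N, (S.filter (fun x => H.Adj x z)).card := by
      change _ = ∑ z ∈ N, (Finset.bipartiteBelow (fun x z => H.Adj x z) S z).card
      rw [← Finset.sum_card_bipartiteAbove_eq_sum_card_bipartiteBelow (fun x z => H.Adj x z)]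
      apply Finset.sum_congr rfl
      intro x hx
      rw [← SimpleGraph.card_neighborFinset_eq_degree]
      congr 1
      ext z
      simp only [SimpleGraph.mem_neighborFinset, Finset.mem_bipartiteAbove, hN, Finset.mem_filter,
        Finset.mem_univ, true_and]
      exact ⟨fun h => ⟨⟨x, hx, h⟩, h⟩, fun h => h.2⟩
    rw [e1, mul_comm]
    apply Finset.sum_le_card_nsmul
    intro z _
    refine (Finset.card_le_card_of_injOn (t := {G.dist u z - 1, G.dist u z, G.dist u z + 1})
      (G.dist u) ?_ ?_).trans Finset.card_le_three
    · intro x hx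
      simp only [Finset.coe_filter, Set.mem_setOf_eq, hS, List.mem_toFinset] at hx
      have := hd x hx.1 z (hHG hx.2)
      simp only [Finset.coe_insert, Finset.coe_singleton, Set.mem_insert_iff,
        Set.mem_singleton_iff]
      omega
    · intro x hx y hy h
      simp only [Finset.coe_filter, Set.mem_setOf_eq, hS, List.mem_toFinset] at hx hy
      exact hinj x hx.1 y hy.1 h
  have hdeg : ∀ x ∈ S, H.degree x ≤ H₀.degree x + 2 := by
    intro x hx
    simp only [hS, List.mem_toFinset] at hx
    rw [← SimpleGraph.card_neighborFinset_eq_degree, ← SimpleGraph.card_neighborFinset_eq_degree]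
    have hsub : H.neighborFinset x ⊆ H₀.neighborFinset x ∪
        Finset.univ.filter (fun y => s(x, y) ∈ p.edges) := by
      intro y hy
      simp only [SimpleGraph.mem_neighborFinset, Finset.mem_union, Finset.mem_filter,
        Finset.mem_univ, true_and] at hy ⊢
      exact ((hadj x y).1 hy).imp id And.left
    refine (Finset.card_le_card hsub).trans ((Finset.card_union_le _ _).trans ?_)
    gcongr
    refine (Finset.card_le_card_of_injOn (t := {G.dist u x - 1, G.dist u x + 1})
      (G.dist u) ?_ ?_).trans Finset.card_le_two
    · intro y hy
      simp only [Finset.coe_filter, Set.mem_setOf_eq, Finset.mem_univ, true_and] at hy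
      have ha := p.adj_of_mem_edges hy
      have h1 := hd x hx y ha
      have hne : G.dist u x ≠ G.dist u y := fun h =>
        ha.ne (hinj x hx y (p.snd_mem_support_of_mem_edges hy) h)
      simp only [Finset.coe_insert, Finset.coe_singleton, Set.mem_insert_iff,
        Set.mem_singleton_iff]
      omega
    · intro y hy y' hy' h
      simp only [Finset.coe_filter, Set.mem_setOf_eq, Finset.mem_univ, true_and] at hy hy'
      exact hinj y (p.snd_mem_support_of_mem_edges hy) y' (p.snd_mem_support_of_mem_edges hy') h
  have hdeg0 : ∀ x, x ∉ S → H.degree x = H₀.degree x := by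
    intro x hx
    simp only [hS, List.mem_toFinset] at hx
    rw [← SimpleGraph.card_neighborFinset_eq_degree, ← SimpleGraph.card_neighborFinset_eq_degree]
    congr 1
    ext y
    simp only [SimpleGraph.mem_neighborFinset, hadj]
    constructor
    · rintro (h | h)
      · exact h
      · exact absurd (p.fst_mem_support_of_mem_edges h.1) hx
    · exact Or.inl
  have hcost : (spannerCost H : ℤ) - spannerCost H₀ ≤ 4 * ∑ x ∈ S, (H.degree x : ℤ) := by
    unfold spannerCost
    push_cast
    rw [← Finset.sum_sub_distrib, Finset.mul_sum]
    rw [← Finset.sum_subset (Finset.subset_univ S)]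
    · apply Finset.sum_le_sum
      intro x hx
      have h1 : (H.degree x : ℤ) ≤ H₀.degree x + 2 := by exact_mod_cast hdeg x hx
      have h2 : (0 : ℤ) ≤ H.degree x := by positivity
      have h3 : (0 : ℤ) ≤ H₀.degree x := by positivity
      have h4 : (H₀.degree x : ℤ) ≤ H.degree x := by
        exact_mod_cast SimpleGraph.degree_le_of_le hH₀H
      nlinarith
    · intro x _ hx
      rw [hdeg0 x hx, sub_self]
  have hcount' : ∑ x ∈ S, (H.degree x : ℤ) ≤ 3 * N.card := by exact_mod_cast hcount
  linarith
end
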